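/- arXiv:1506.06124 — 2 statements merged into one kernel-verified Lean document; each statement's English description precedes it below -/
import Mathlib

section
/- Let k ≥ 2 be an integer and let p^k(n) denote the number of partitions of n into parts that are perfect k-th powers. Then log p^k(n) ∼ (k+1)·((1/k²)ζ((k+1)/k)Γ(1/k))^{k/(k+1)} · n^{1/(k+1)} as n → ∞. -/
open Real Complex Filter

/-- Real value of the Riemann zeta function at a real argument. -/
noncomputable def zetaR (x : ℝ) : ℝ := (riemannZeta (x : ℂ)).re

/-- The number of partitions of `n` into parts that are perfect `k`-th powers. -/
noncomputable def pk (k n : ℕ) : ℕ :=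
  Nat.card {p : n.Partition // ∀ i ∈ p.parts, ∃ m : ℕ, i = m ^ k}

/-- The tangent line to the convex function `x ↦ A * x ^ (-α)` lies strictly below its graph. -/
theorem rpow_neg_tangent_lt {A α x e : ℝ} (hA : 0 < A) (hα : 0 < α) (hx : 0 < x) (he : 0 < e)
    (hxe : x ≠ e) :
    A * e ^ (-α) + α * A * e ^ (-1 - α) * e < A * x ^ (-α) + α * A * e ^ (-1 - α) * x := by
  have h1 : Real.log (x / e) < x / e - 1 :=
    Real.log_lt_sub_one_of_pos (div_pos hx he) (by rwa [Ne, div_eq_one_iff_eq he.ne'])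
  have h2 : 1 - α * Real.log (x / e) ≤ (x / e) ^ (-α) := by
    rw [Real.rpow_def_of_pos (div_pos hx he)]
    linarith [Real.add_one_le_exp (Real.log (x / e) * -α)]
  have h3 : x ^ (-α) = (x / e) ^ (-α) * e ^ (-α) := by
    rw [← Real.mul_rpow (div_pos hx he).le he.le, div_mul_cancel₀ _ he.ne']
  have h4 : e ^ (-1 - α) = e ^ (-α) / e := by
    rw [show -1 - α = -α - 1 by ring, Real.rpow_sub_one he.ne']
  have h5 : 0 < e ^ (-α) := Real.rpow_pos_of_pos he _
  have h6 : 1 - α * (x / e - 1) < (x / e) ^ (-α) := by nlinarith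
  have h7 := mul_lt_mul_of_pos_left h6 (mul_pos hA h5)
  rw [h3, h4]
  have e1 : α * A * (e ^ (-α) / e) * e = α * A * e ^ (-α) := by field_simp
  have e2 : α * A * (e ^ (-α) / e) * x = α * A * e ^ (-α) * (x / e) := by ring
  rw [e1, e2]
  linarith

/-- The logarithm of a linear function of `n` is negligible against any positive power of `n`. -/
theorem tendsto_log_natCast_div_rpow {γ : ℝ} (hγ : 0 < γ) (c : ℝ) (hc : 0 < c) :
    Tendsto (fun n : ℕ => Real.log (c * ((n : ℝ) + 1)) / (n : ℝ) ^ γ) atTop (nhds 0) := by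
  have h1 : Tendsto (fun n : ℕ => ((n : ℝ)) ^ γ) atTop atTop :=
    (tendsto_rpow_atTop hγ).comp tendsto_natCast_atTop_atTop
  have h2 : Tendsto (fun n : ℕ => Real.log (n : ℝ) / (n : ℝ) ^ γ) atTop (nhds 0) :=
    ((isLittleO_log_rpow_atTop hγ).tendsto_div_nhds_zero).comp tendsto_natCast_atTop_atTop
  have h3 : Tendsto (fun n : ℕ => Real.log (2 * c) / (n : ℝ) ^ γ) atTop (nhds 0) :=
    h1.const_div_atTop _
  have h4 : Tendsto (fun n : ℕ => Real.log c / (n : ℝ) ^ γ) atTop (nhds 0) :=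
    h1.const_div_atTop _
  refine tendsto_of_tendsto_of_tendsto_of_le_of_le' h4 (by simpa using h3.add h2) ?_ ?_
  · filter_upwards with n
    gcongr
    nlinarith [(n.cast_nonneg : (0 : ℝ) ≤ n)]
  · filter_upwards [eventually_ge_atTop 1] with n hn
    have hn' : (1 : ℝ) ≤ n := by exact_mod_cast hn
    rw [← add_div, ← Real.log_mul (by positivity) (by positivity)]
    refine div_le_div_of_nonneg_right (Real.log_le_log (by positivity) ?_) (by positivity)
    nlinarith

section Tauberian

variable {a : ℕ → ℝ} {L : ℝ → ℝ}

/-- Chernoff bound for the upper tail of a Laplace series. -/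
theorem tsum_tail_le (ha : ∀ n, 0 ≤ a n) {s t : ℝ} (hts : t ≤ s) (N : ℕ)
    (ht : HasSum (fun n : ℕ => a n * Real.exp (-(n * t))) (Real.exp (L t)))
    (hs : HasSum (fun n : ℕ => a n * Real.exp (-(n * s))) (Real.exp (L s))) :
    Real.exp (L s) - ∑ n ∈ Finset.range (N + 1), a n * Real.exp (-(n * s)) ≤
      Real.exp (L t - N * (s - t)) := by
  have h1 := (hasSum_nat_add_iff' (N + 1)).2 hs
  have h2 := ht.mul_left (Real.exp (-(N * (s - t))))
  have h3 := (hasSum_nat_add_iff' (N + 1)).2 h2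
  have h4 : Real.exp (L t - N * (s - t)) =
      Real.exp (-(N * (s - t))) * Real.exp (L t) := by
    rw [← Real.exp_add]; congr 1; ring
  have h5 : 0 ≤ ∑ n ∈ Finset.range (N + 1),
      Real.exp (-(N * (s - t))) * (a n * Real.exp (-(n * t))) :=
    Finset.sum_nonneg fun n _ => by have := ha n; positivity
  rw [h4]
  refine le_trans (hasSum_le (fun n => ?_) h1 h3) (by linarith)
  rw [mul_left_comm, ← Real.exp_add]
  refine mul_le_mul_of_nonneg_left (Real.exp_le_exp.2 ?_) (ha _)
  push_cast
  nlinarith [mul_nonneg (n.cast_nonneg : (0 : ℝ) ≤ n) (sub_nonneg.2 hts)]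

/-- Chernoff bound for the lower part of a Laplace series. -/
theorem sum_filter_lt_le (ha : ∀ n, 0 ≤ a n) {s t : ℝ} (hst : s ≤ t) (M : ℝ) (S : Finset ℕ)
    (ht : HasSum (fun n : ℕ => a n * Real.exp (-(n * t))) (Real.exp (L t))) :
    ∑ n ∈ S.filter (fun n : ℕ => (n : ℝ) < M), a n * Real.exp (-(n * s)) ≤ Real.exp (L t + M * (t - s)) := by
  have h4 : Real.exp (L t + M * (t - s)) = Real.exp (M * (t - s)) * Real.exp (L t) := by
    rw [← Real.exp_add]; congr 1; ring
  rw [h4]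
  refine le_trans (Finset.sum_le_sum fun n hn => ?_)
    (sum_le_hasSum (S.filter fun n : ℕ => (n : ℝ) < M)
      (fun n _ => ?_) (ht.mul_left (Real.exp (M * (t - s)))))
  · rw [mul_left_comm, ← Real.exp_add]
    refine mul_le_mul_of_nonneg_left (Real.exp_le_exp.2 ?_) (ha _)
    nlinarith [(Finset.mem_filter.1 hn).2]
  · have := ha n; positivity

/-- If both tails of a Laplace series are small then `a N` is large. -/
theorem log_ge_of_tails_small (hmono : Monotone a) (h0 : 1 ≤ a 0) {s t u : ℝ} (hs : 0 < s)
    (hts : t ≤ s) (hsu : s ≤ u) (N : ℕ) (M : ℝ)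
    (hS : HasSum (fun n : ℕ => a n * Real.exp (-(n * s))) (Real.exp (L s)))
    (hT : HasSum (fun n : ℕ => a n * Real.exp (-(n * t))) (Real.exp (L t)))
    (hU : HasSum (fun n : ℕ => a n * Real.exp (-(n * u))) (Real.exp (L u)))
    (h1 : L t - N * (s - t) ≤ L s - Real.log 3) (h2 : L u + M * (u - s) ≤ L s - Real.log 3) :
    L s + M * s - Real.log (3 * ((N : ℝ) + 1)) ≤ Real.log (a N) := by
  have ha : ∀ n, 1 ≤ a n := fun n => h0.trans (hmono n.zero_le)
  have ha' : ∀ n, 0 ≤ a n := fun n => zero_le_one.trans (ha n)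
  have e3 : Real.exp (L s - Real.log 3) = Real.exp (L s) / 3 := by
    rw [Real.exp_sub, Real.exp_log (by norm_num)]
  have k1 := (tsum_tail_le ha' hts N hT hS).trans (Real.exp_le_exp.2 h1)
  have k2 := (sum_filter_lt_le ha' hsu M (Finset.range (N + 1)) hU).trans (Real.exp_le_exp.2 h2)
  rw [e3] at k1 k2
  have k3 := Finset.sum_filter_add_sum_filter_not (Finset.range (N + 1)) (fun n : ℕ => (n : ℝ) < M)
    (fun n => a n * Real.exp (-(n * s)))
  have k4 : ∑ n ∈ (Finset.range (N + 1)).filter (fun n : ℕ => ¬ ((n : ℝ) < M)), a n * Real.exp (-(n * s)) ≤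
      ((N : ℝ) + 1) * (a N * Real.exp (-(M * s))) := by
    calc _ ≤ ∑ n ∈ (Finset.range (N + 1)).filter (fun n : ℕ => ¬ ((n : ℝ) < M)), a N * Real.exp (-(M * s)) := by
          refine Finset.sum_le_sum fun n hn => ?_
          obtain ⟨hn1, hn2⟩ := Finset.mem_filter.1 hn
          have := Finset.mem_range.1 hn1
          refine mul_le_mul (hmono (by omega)) (Real.exp_le_exp.2 ?_) (Real.exp_pos _).le (ha' _)
          nlinarith
      _ ≤ _ := by
          rw [Finset.sum_const, nsmul_eq_mul]
          refine mul_le_mul_of_nonneg_right ?_ (mul_nonneg (ha' _) (Real.exp_pos _).le)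
          have := Finset.card_filter_le (Finset.range (N + 1)) (fun n : ℕ => ¬ ((n : ℝ) < M))
          rw [Finset.card_range] at this
          exact_mod_cast this
  have k5 : Real.exp (L s) ≤ (3 * ((N : ℝ) + 1)) * (a N * Real.exp (-(M * s))) := by linarith
  have haN : 0 < a N := zero_lt_one.trans_le (ha N)
  have k6 := (Real.le_log_iff_exp_le (by positivity)).2 k5
  rw [Real.log_mul (by positivity) (by positivity), Real.log_mul haN.ne' (Real.exp_pos _).ne',
    Real.log_exp] at k6
  linarith

/-- An exponential Tauberian theorem: the logarithmic behaviour at `0` of a Laplace series with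
monotone coefficients determines the logarithmic behaviour of the coefficients. -/
theorem tendsto_log_div_rpow_of_laplace (hmono : Monotone a) (h0 : 1 ≤ a 0) {A α : ℝ} (hA : 0 < A)
    (hα : 0 < α)
    (hsum : ∀ s : ℝ, 0 < s → HasSum (fun n : ℕ => a n * Real.exp (-(n * s))) (Real.exp (L s)))
    (hL : Tendsto (fun s => s ^ α * L s) (nhdsWithin 0 (Set.Ioi 0)) (nhds A)) :
    Tendsto (fun n : ℕ => Real.log (a n) / (n : ℝ) ^ (α / (1 + α))) atTop
      (nhds ((1 + 1 / α) * (α * A) ^ (1 / (1 + α)))) := by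
  set β : ℝ := 1 / (1 + α) with hβ
  have hβ0 : 0 < β := by positivity
  set γ : ℝ := α / (1 + α) with hγ
  have hγ0 : 0 < γ := by positivity
  have hγβ : γ = α * β := by rw [hγ, hβ]; ring
  have hγβ1 : 1 - β = γ := by rw [hγ, hβ]; field_simp; ring
  have hytop : Tendsto (fun n : ℕ => (n : ℝ) ^ γ) atTop atTop :=
    (tendsto_rpow_atTop hγ0).comp tendsto_natCast_atTop_atTop
  have ha : ∀ n, 1 ≤ a n := fun n => h0.trans (hmono n.zero_le)
  have hrn : ∀ n : ℕ, 1 ≤ n → ∀ c : ℝ, (n : ℝ) * (c * (n : ℝ) ^ (-β)) = c * (n : ℝ) ^ γ := by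
    intro n hn c
    have hn' : (0 : ℝ) < n := by exact_mod_cast hn
    rw [← hγβ1, sub_eq_add_neg, Real.rpow_add hn', Real.rpow_one]; ring
  have hLc : ∀ c : ℝ, 0 < c →
      Tendsto (fun n : ℕ => L (c * (n : ℝ) ^ (-β)) / (n : ℝ) ^ γ) atTop
        (nhds (A * c ^ (-α))) := by
    intro c hc
    have hr0 : Tendsto (fun n : ℕ => c * (n : ℝ) ^ (-β)) atTop (nhdsWithin 0 (Set.Ioi 0)) := by
      refine tendsto_nhdsWithin_iff.2 ⟨?_, ?_⟩
      · simpa using ((tendsto_rpow_neg_atTop hβ0).comp tendsto_natCast_atTop_atTop).const_mul c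
      · filter_upwards [eventually_ge_atTop 1] with n hn
        have hn' : (0 : ℝ) < n := by exact_mod_cast hn
        exact mul_pos hc (Real.rpow_pos_of_pos hn' _)
    refine ((hL.comp hr0).mul_const (c ^ (-α))).congr' ?_
    filter_upwards [eventually_ge_atTop 1] with n hn
    have hn' : (0 : ℝ) < n := by exact_mod_cast hn
    simp only [Function.comp]
    rw [Real.mul_rpow hc.le (Real.rpow_pos_of_pos hn' _).le, ← Real.rpow_mul hn'.le,
      Real.rpow_neg hc.le, show -β * α = -γ by rw [hγβ]; ring, Real.rpow_neg hn'.le]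
    have := Real.rpow_pos_of_pos hc α
    field_simp
  set c₀ : ℝ := (α * A) ^ β with hc₀
  have hc₀0 : 0 < c₀ := Real.rpow_pos_of_pos (by positivity) _
  have hc₀pow : α * A * c₀ ^ (-1 - α) = 1 := by
    rw [hc₀, ← Real.rpow_mul (by positivity), show β * (-1 - α) = -1 by rw [hβ]; field_simp; ring,
      Real.rpow_neg_one]
    exact mul_inv_cancel₀ (by positivity)
  have hc₀val : A * c₀ ^ (-α) + c₀ = (1 + 1 / α) * c₀ := by
    have : c₀ ^ (-α) = c₀ ^ (-1 - α) * c₀ := by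
      rw [← Real.rpow_add_one hc₀0.ne']; congr 1; ring
    rw [this]
    have h2 : A * c₀ ^ (-1 - α) = 1 / α := by field_simp; linarith
    rw [← mul_assoc, h2]; ring
  rw [← hc₀val]
  refine tendsto_order.2 ⟨fun l hl => ?_, fun r hr => ?_⟩
  · obtain ⟨c, e, hc, hce, hlce⟩ : ∃ c e : ℝ, c₀ < c ∧ c < e ∧
        l < A * c ^ (-α) + α * A * e ^ (-1 - α) * c := by
      have hcont : ContinuousAt (fun t : ℝ => A * (c₀ + t) ^ (-α) +
          α * A * (c₀ + 2 * t) ^ (-1 - α) * (c₀ + t)) 0 := by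
        refine ContinuousAt.add ?_ (ContinuousAt.mul ?_ (by fun_prop))
        · exact continuousAt_const.mul (ContinuousAt.rpow_const (by fun_prop)
            (Or.inl (by simpa using hc₀0.ne')))
        · exact continuousAt_const.mul (ContinuousAt.rpow_const (by fun_prop)
            (Or.inl (by simpa using hc₀0.ne')))
      have hev := hcont.eventually (lt_mem_nhds (a := l) (by simpa [hc₀pow] using hl))
      obtain ⟨t, ht, ht0⟩ : ∃ t : ℝ, _ ∧ 0 < t := ((hev.filter_mono nhdsWithin_le_nhds).and
        (self_mem_nhdsWithin : Set.Ioi (0 : ℝ) ∈ nhdsWithin 0 (Set.Ioi 0))).exists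
      exact ⟨c₀ + t, c₀ + 2 * t, by linarith, by linarith, ht⟩
    have hc0 : 0 < c := hc₀0.trans hc
    have he0 : 0 < e := hc0.trans hce
    set θ : ℝ := α * A * e ^ (-1 - α) with hθ
    have q1 : A * c₀ ^ (-α) + c₀ < A * c ^ (-α) + c := by
      simpa [hc₀pow] using rpow_neg_tangent_lt hA hα hc0 hc₀0 hc.ne'
    have q2 : A * e ^ (-α) + θ * e < A * c ^ (-α) + θ * c :=
      rpow_neg_tangent_lt hA hα hc0 he0 hce.ne
    have hlog3 : Tendsto (fun n : ℕ => Real.log 3 / (n : ℝ) ^ γ) atTop (nhds 0) :=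
      hytop.const_div_atTop _
    have ev1 := ((hLc c₀ hc₀0).sub_const (c - c₀)).eventually_lt
      ((hLc c hc0).sub hlog3) (by linarith)
    have ev2 := ((hLc e he0).add_const (θ * (e - c))).eventually_lt
      ((hLc c hc0).sub hlog3) (by linarith)
    have ev3 := (((hLc c hc0).add_const (θ * c)).sub
      (tendsto_log_natCast_div_rpow hγ0 3 (by norm_num))).eventually
        (lt_mem_nhds (a := l) (by simpa using hlce))
    filter_upwards [ev1, ev2, ev3, eventually_ge_atTop 1] with N e1 e2 e3 hN
    have hN' : (0 : ℝ) < N := by exact_mod_cast hN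
    have hy : 0 < (N : ℝ) ^ γ := Real.rpow_pos_of_pos hN' _
    have hr : 0 < (N : ℝ) ^ (-β) := Real.rpow_pos_of_pos hN' _
    refine e3.trans_le ?_
    have key := log_ge_of_tails_small (L := L) hmono h0 (s := c * (N : ℝ) ^ (-β))
      (t := c₀ * (N : ℝ) ^ (-β)) (u := e * (N : ℝ) ^ (-β)) (by positivity)
      (by gcongr) (by gcongr) N (θ * N) (hsum _ (by positivity)) (hsum _ (by positivity))
      (hsum _ (by positivity)) ?_ ?_
    · rw [mul_assoc, hrn N hN] at key
      rw [le_div_iff₀ hy]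
      refine le_trans (le_of_eq ?_) key
      field_simp
    · rw [← sub_mul, hrn N hN]
      have := mul_le_mul_of_nonneg_right e1.le hy.le
      rw [sub_mul _ (c - c₀), sub_mul _ (Real.log 3 / _), div_mul_cancel₀ _ hy.ne', div_mul_cancel₀ _ hy.ne',
        div_mul_cancel₀ _ hy.ne'] at this
      exact this
    · rw [← sub_mul, mul_assoc, hrn N hN]
      have := mul_le_mul_of_nonneg_right e2.le hy.le
      rw [sub_mul, add_mul, div_mul_cancel₀ _ hy.ne', div_mul_cancel₀ _ hy.ne',
        div_mul_cancel₀ _ hy.ne'] at this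
      linarith
  · have ev := ((hLc c₀ hc₀0).add_const c₀).eventually (gt_mem_nhds hr)
    filter_upwards [ev, eventually_ge_atTop 1] with N e1 hN
    have hN' : (0 : ℝ) < N := by exact_mod_cast hN
    have hy : 0 < (N : ℝ) ^ γ := Real.rpow_pos_of_pos hN' _
    have hr : 0 < (N : ℝ) ^ (-β) := Real.rpow_pos_of_pos hN' _
    refine lt_of_le_of_lt ?_ e1
    have haN : 0 < a N := zero_lt_one.trans_le (ha N)
    have h1 := le_hasSum (hsum (c₀ * (N : ℝ) ^ (-β)) (by positivity)) N
      (fun n _ => mul_nonneg (zero_le_one.trans (ha n)) (Real.exp_pos _).le)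
    have h2 := Real.log_le_log (by positivity) h1
    rw [Real.log_exp, Real.log_mul haN.ne' (Real.exp_pos _).ne', Real.log_exp, hrn N hN] at h2
    rw [div_add' _ _ _ hy.ne']
    gcongr
    linarith

end Tauberian

/-- The theta-like sum `∑ exp (-b m ^ k)` over `m ≥ 1`. -/
noncomputable def expPowSum (k : ℕ) (b : ℝ) : ℝ := ∑' m : ℕ, Real.exp (-(b * ((m : ℝ) + 1) ^ k))

theorem expPowSum_nonneg (k : ℕ) (b : ℝ) : 0 ≤ expPowSum k b :=
  tsum_nonneg fun _ => (Real.exp_pos _).le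

section

variable {k : ℕ} {b : ℝ}

theorem antitoneOn_exp_neg_mul_pow (k : ℕ) (hb : 0 < b) :
    AntitoneOn (fun x : ℝ => Real.exp (-(b * x ^ k))) (Set.Ici 0) := by
  intro x hx y hy hxy
  have : (0 : ℝ) ≤ x := hx
  simp only
  gcongr

theorem integral_exp_neg_mul_pow (hk : k ≠ 0) (hb : 0 < b) :
    ∫ x in Set.Ioi (0 : ℝ), Real.exp (-(b * x ^ k)) =
      b ^ (-(1 / (k : ℝ))) * Real.Gamma (1 / k + 1) := by
  have hk' : (0 : ℝ) < k := by positivity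
  have := integral_exp_neg_mul_rpow hk' hb
  simpa [neg_div] using this

theorem integrableOn_exp_neg_mul_pow (hk : k ≠ 0) (hb : 0 < b) :
    MeasureTheory.IntegrableOn (fun x : ℝ => Real.exp (-(b * x ^ k))) (Set.Ioi 0) := by
  have hk' : (0 : ℝ) < k := by positivity
  simpa using integrableOn_rpow_mul_exp_neg_mul_rpow (s := 0) (by norm_num) hk' hb

theorem sum_exp_neg_mul_pow_le (hk : k ≠ 0) (hb : 0 < b) (n : ℕ) :
    ∑ m ∈ Finset.range n, Real.exp (-(b * ((m : ℝ) + 1) ^ k)) ≤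
      b ^ (-(1 / (k : ℝ))) * Real.Gamma (1 / k + 1) := by
  have h1 := AntitoneOn.sum_le_integral (x₀ := 0) (a := n)
    ((antitoneOn_exp_neg_mul_pow k hb).mono fun x hx => hx.1)
  simp only [zero_add, Nat.cast_add, Nat.cast_one] at h1
  refine h1.trans ?_
  rw [← integral_exp_neg_mul_pow hk hb, intervalIntegral.integral_of_le n.cast_nonneg]
  exact MeasureTheory.setIntegral_mono_set (integrableOn_exp_neg_mul_pow hk hb)
    (Eventually.of_forall fun _ => (Real.exp_pos _).le) Set.Ioc_subset_Ioi_self.eventuallyLE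

theorem summable_exp_neg_mul_pow (hk : k ≠ 0) (hb : 0 < b) :
    Summable fun m : ℕ => Real.exp (-(b * ((m : ℝ) + 1) ^ k)) :=
  summable_of_sum_range_le (fun _ => (Real.exp_pos _).le) (sum_exp_neg_mul_pow_le hk hb)

theorem expPowSum_le (hk : k ≠ 0) (hb : 0 < b) :
    expPowSum k b ≤ b ^ (-(1 / (k : ℝ))) * Real.Gamma (1 / k + 1) :=
  Real.tsum_le_of_sum_range_le (fun _ => (Real.exp_pos _).le) (sum_exp_neg_mul_pow_le hk hb)

theorem le_one_add_expPowSum (hk : k ≠ 0) (hb : 0 < b) :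
    b ^ (-(1 / (k : ℝ))) * Real.Gamma (1 / k + 1) ≤ 1 + expPowSum k b := by
  rw [← integral_exp_neg_mul_pow hk hb]
  refine le_of_tendsto (MeasureTheory.intervalIntegral_tendsto_integral_Ioi 0
    (integrableOn_exp_neg_mul_pow hk hb) tendsto_natCast_atTop_atTop)
    (Eventually.of_forall fun n => ?_)
  have h1 := AntitoneOn.integral_le_sum (x₀ := 0) (a := n)
    ((antitoneOn_exp_neg_mul_pow k hb).mono fun x hx => hx.1)
  simp only [zero_add] at h1
  refine h1.trans ?_
  calc _ ≤ ∑ i ∈ Finset.range (n + 1), Real.exp (-(b * (i : ℝ) ^ k)) :=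
        Finset.sum_le_sum_of_subset_of_nonneg (Finset.range_mono n.le_succ)
          fun _ _ _ => (Real.exp_pos _).le
    _ = 1 + ∑ m ∈ Finset.range n, Real.exp (-(b * ((m : ℝ) + 1) ^ k)) := by
        rw [Finset.sum_range_succ']
        simp [hk, add_comm]
    _ ≤ _ := by
        gcongr
        exact (summable_exp_neg_mul_pow hk hb).sum_le_tsum _ fun _ _ => (Real.exp_pos _).le

theorem tendsto_rpow_mul_expPowSum (hk : k ≠ 0) :
    Tendsto (fun b => b ^ (1 / (k : ℝ)) * expPowSum k b) (nhdsWithin 0 (Set.Ioi 0))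
      (nhds (Real.Gamma (1 / k + 1))) := by
  have hk' : (0 : ℝ) < 1 / k := by positivity
  have h0 : Tendsto (fun b : ℝ => b ^ (1 / (k : ℝ))) (nhdsWithin 0 (Set.Ioi 0)) (nhds 0) := by
    have := (Real.continuousAt_rpow_const 0 (1 / (k : ℝ)) (Or.inr hk'.le)).tendsto
    rw [Real.zero_rpow hk'.ne'] at this
    exact this.mono_left nhdsWithin_le_nhds
  have key : ∀ b : ℝ, 0 < b → b ^ (1 / (k : ℝ)) * (b ^ (-(1 / (k : ℝ))) * Real.Gamma (1 / k + 1)) =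
      Real.Gamma (1 / k + 1) := fun b hb => by
    rw [← mul_assoc, ← Real.rpow_add hb, add_neg_cancel, Real.rpow_zero, one_mul]
  refine tendsto_of_tendsto_of_tendsto_of_le_of_le' (f := fun b => b ^ (1 / (k : ℝ)) * expPowSum k b)
    (by simpa only [sub_zero] using (tendsto_const_nhds (x := Real.Gamma (1 / k + 1))).sub h0)
    tendsto_const_nhds ?_ ?_
  · filter_upwards [self_mem_nhdsWithin] with b hb
    have hb : 0 < b := hb
    have := mul_le_mul_of_nonneg_left (le_one_add_expPowSum hk hb)
      (Real.rpow_nonneg hb.le (1 / (k : ℝ)))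
    rw [key b hb] at this
    linarith
  · filter_upwards [self_mem_nhdsWithin] with b hb
    have hb : 0 < b := hb
    have := mul_le_mul_of_nonneg_left (expPowSum_le hk hb)
      (Real.rpow_nonneg hb.le (1 / (k : ℝ)))
    rwa [key b hb] at this

/-- The logarithm of the generating function `∏ (1 - exp (-s m ^ k))⁻¹`. -/
noncomputable def logGenFun (k : ℕ) (s : ℝ) : ℝ :=
  ∑' j : ℕ, expPowSum k (s * ((j : ℝ) + 1)) / ((j : ℝ) + 1)

theorem summable_natCast_add_one_rpow {p : ℝ} (hp : p < -1) :
    Summable fun j : ℕ => ((j : ℝ) + 1) ^ p := by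
  simpa using (summable_nat_add_iff 1).2 (Real.summable_nat_rpow.2 hp)

theorem expPowSum_div_le (hk : k ≠ 0) {s : ℝ} (hs : 0 < s) (j : ℕ) :
    expPowSum k (s * ((j : ℝ) + 1)) / ((j : ℝ) + 1) ≤
      s ^ (-(1 / (k : ℝ))) * (Real.Gamma (1 / k + 1) * ((j : ℝ) + 1) ^ (-(1 / (k : ℝ)) - 1)) := by
  have hj : (0 : ℝ) < (j : ℝ) + 1 := by positivity
  rw [Real.rpow_sub_one hj.ne']
  refine (div_le_div_of_nonneg_right (expPowSum_le hk (mul_pos hs hj)) hj.le).trans (le_of_eq ?_)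
  rw [Real.mul_rpow hs.le hj.le]
  ring

theorem summable_expPowSum_div (hk : k ≠ 0) {s : ℝ} (hs : 0 < s) :
    Summable fun j : ℕ => expPowSum k (s * ((j : ℝ) + 1)) / ((j : ℝ) + 1) := by
  have hk' : (0 : ℝ) < 1 / k := by positivity
  refine Summable.of_nonneg_of_le (fun j => div_nonneg (expPowSum_nonneg _ _) (by positivity))
    (expPowSum_div_le hk hs)
    (((summable_natCast_add_one_rpow (by linarith)).mul_left _).mul_left _)

theorem tendsto_rpow_mul_logGenFun (hk : k ≠ 0) :
    Tendsto (fun s => s ^ (1 / (k : ℝ)) * logGenFun k s) (nhdsWithin 0 (Set.Ioi 0))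
      (nhds (Real.Gamma (1 / k + 1) * ∑' j : ℕ, ((j : ℝ) + 1) ^ (-(1 / (k : ℝ)) - 1))) := by
  have hk' : (0 : ℝ) < 1 / k := by positivity
  simp_rw [logGenFun, ← tsum_mul_left]
  refine tendsto_tsum_of_dominated_convergence (bound := fun j : ℕ =>
    Real.Gamma (1 / k + 1) * ((j : ℝ) + 1) ^ (-(1 / (k : ℝ)) - 1))
    ((summable_natCast_add_one_rpow (by linarith)).mul_left _) (fun j => ?_) ?_
  · have hj : (0 : ℝ) < (j : ℝ) + 1 := by positivity
    have h1 : Tendsto (fun s : ℝ => s * ((j : ℝ) + 1)) (nhdsWithin 0 (Set.Ioi 0))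
        (nhdsWithin 0 (Set.Ioi 0)) := by
      refine tendsto_nhdsWithin_iff.2 ⟨?_, ?_⟩
      · have : Tendsto (fun s : ℝ => s * ((j : ℝ) + 1)) (nhds 0) (nhds (0 * ((j : ℝ) + 1))) :=
          tendsto_id.mul_const _
        rw [zero_mul] at this
        exact this.mono_left nhdsWithin_le_nhds
      · filter_upwards [self_mem_nhdsWithin] with s hs
        exact mul_pos hs hj
    refine (((tendsto_rpow_mul_expPowSum hk).comp h1).mul_const
      (((j : ℝ) + 1) ^ (-(1 / (k : ℝ)) - 1))).congr' ?_
    filter_upwards [self_mem_nhdsWithin] with s hs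
    have hs : 0 < s := hs
    simp only [Function.comp]
    rw [Real.rpow_sub_one hj.ne', Real.mul_rpow hs.le hj.le, Real.rpow_neg hj.le]
    have := Real.rpow_pos_of_pos hj (1 / (k : ℝ))
    field_simp
  · filter_upwards [self_mem_nhdsWithin] with s hs j
    have hs : 0 < s := hs
    have hj : (0 : ℝ) < (j : ℝ) + 1 := by positivity
    have hr := Real.rpow_pos_of_pos hs (1 / (k : ℝ))
    rw [Real.norm_of_nonneg (mul_nonneg hr.le (div_nonneg (expPowSum_nonneg _ _) hj.le))]
    refine (mul_le_mul_of_nonneg_left (expPowSum_div_le hk hs j) hr.le).trans (le_of_eq ?_)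
    rw [← mul_assoc, ← Real.rpow_add hs, add_neg_cancel, Real.rpow_zero, one_mul]

theorem hasSum_neg_log_one_sub_exp (hk : k ≠ 0) {s : ℝ} (hs : 0 < s) :
    HasSum (fun m : ℕ => -Real.log (1 - Real.exp (-(((m + 1) ^ k : ℕ) * s)))) (logGenFun k s) := by
  set f : ℕ × ℕ → ℝ := fun p =>
    Real.exp (-(s * ((p.1 : ℝ) + 1) * ((p.2 : ℝ) + 1) ^ k)) / ((p.1 : ℝ) + 1) with hf
  have hrow : ∀ j : ℕ, HasSum (fun m : ℕ => f (j, m))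
      (expPowSum k (s * ((j : ℝ) + 1)) / ((j : ℝ) + 1)) := fun j => by
    have hj : 0 < s * ((j : ℝ) + 1) := by positivity
    exact (summable_exp_neg_mul_pow hk hj).hasSum.div_const ((j : ℝ) + 1)
  have hsum : Summable f := by
    refine (summable_prod_of_nonneg fun p => by positivity).2 ⟨fun j => (hrow j).summable, ?_⟩
    simp_rw [(hrow _).tsum_eq]
    exact summable_expPowSum_div hk hs
  have htot : HasSum f (logGenFun k s) := by
    have := hsum.hasSum
    rw [hsum.tsum_prod] at this
    simpa only [(hrow _).tsum_eq, ← logGenFun.eq_1] using this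
  refine HasSum.prod_fiberwise ((Equiv.prodComm ℕ ℕ).hasSum_iff.2 htot) fun m => ?_
  have hx : |Real.exp (-(((m + 1) ^ k : ℕ) * s))| < 1 := by
    rw [abs_of_pos (Real.exp_pos _), Real.exp_lt_one_iff, neg_lt_zero]
    positivity
  convert Real.hasSum_pow_div_log_of_abs_lt_one hx using 2 with j
  simp only [hf, Function.comp, Equiv.prodComm_apply, Prod.swap]
  rw [← Real.exp_nat_mul]
  congr 2
  push_cast
  ring

end

section

open PowerSeries

/-- `f` has nonnegative coefficients, constant coefficient `1`, and value `v` at `x`. -/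
structure HasNonnegValue (f : ℝ⟦X⟧) (x v : ℝ) : Prop where
  coeff_nonneg : ∀ n, 0 ≤ coeff n f
  coeff_zero : coeff 0 f = 1
  hasSum : HasSum (fun n => coeff n f * x ^ n) v

namespace HasNonnegValue

variable {f g : ℝ⟦X⟧} {x v w : ℝ}

theorem one (x : ℝ) : HasNonnegValue 1 x 1 where
  coeff_nonneg n := by rw [coeff_one]; split_ifs <;> norm_num
  coeff_zero := by simp
  hasSum := by
    convert hasSum_single (f := fun n => coeff n (1 : ℝ⟦X⟧) * x ^ n) 0
      (fun n hn => by simp [coeff_one, hn]) using 1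
    simp

theorem mul (hf : HasNonnegValue f x v) (hg : HasNonnegValue g x w) :
    HasNonnegValue (f * g) x (v * w) where
  coeff_nonneg n := by
    rw [coeff_mul]
    exact Finset.sum_nonneg fun p _ => mul_nonneg (hf.coeff_nonneg _) (hg.coeff_nonneg _)
  coeff_zero := by rw [coeff_mul]; simp [hf.coeff_zero, hg.coeff_zero]
  hasSum := by
    have nf : Summable fun n => ‖coeff n f * x ^ n‖ := hf.hasSum.summable.norm
    have ng : Summable fun n => ‖coeff n g * x ^ n‖ := hg.hasSum.summable.norm
    have h1 := (summable_norm_sum_mul_antidiagonal_of_summable_norm nf ng).of_norm.hasSum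
    rw [← tsum_mul_tsum_eq_tsum_sum_antidiagonal_of_summable_norm nf ng, hf.hasSum.tsum_eq,
      hg.hasSum.tsum_eq] at h1
    refine h1.congr_fun ?_
    intro n
    rw [coeff_mul, Finset.sum_mul]
    refine Finset.sum_congr rfl fun p hp => ?_
    rw [← Finset.HasAntidiagonal.mem_antidiagonal.1 hp, pow_add]
    ring

theorem coeff_le_coeff_mul (hf : HasNonnegValue f x v) (hg : HasNonnegValue g x w) (n : ℕ) :
    coeff n f ≤ coeff n (f * g) := by
  rw [coeff_mul]
  refine le_trans (le_of_eq ?_) (Finset.single_le_sum (a := (n, 0))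
    (f := fun p : ℕ × ℕ => coeff p.1 f * coeff p.2 g)
    (fun p _ => mul_nonneg (hf.coeff_nonneg _) (hg.coeff_nonneg _))
    (Finset.HasAntidiagonal.mem_antidiagonal.2 (add_zero n)))
  simp only [hg.coeff_zero, mul_one]

open PowerSeries.WithPiTopology in
theorem geometric {i : ℕ} (hi : i ≠ 0) (hx : 0 ≤ x) (hx1 : x < 1) :
    HasNonnegValue (∑' j : ℕ, (X : ℝ⟦X⟧) ^ (i * j)) x (1 - x ^ i)⁻¹ := by
  have hS : Summable fun j : ℕ => (X : ℝ⟦X⟧) ^ (i * j) := by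
    simp_rw [pow_mul]
    exact summable_pow_of_constantCoeff_eq_zero (by simp [hi])
  have hc := (hasSum_iff_hasSum_coeff ℝ).1 hS.hasSum
  have hinj : Function.Injective fun j : ℕ => i * j := mul_right_injective₀ hi
  have h1 : ∀ j, coeff (i * j) (∑' j : ℕ, (X : ℝ⟦X⟧) ^ (i * j)) = 1 := fun j => by
    refine (hc (i * j)).unique ?_
    have := hasSum_single (f := fun b : ℕ => coeff (i * j) ((X : ℝ⟦X⟧) ^ (i * b))) j
      fun b hb => by rw [coeff_X_pow, if_neg fun h => hb (hinj h).symm]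
    simpa only [coeff_X_pow_self] using this
  have h2 : ∀ n, n ∉ Set.range (fun j : ℕ => i * j) →
      coeff n (∑' j : ℕ, (X : ℝ⟦X⟧) ^ (i * j)) = 0 := fun n hn => by
    refine (hc n).unique ?_
    convert hasSum_zero with b
    rw [coeff_X_pow, if_neg fun h => hn ⟨b, h.symm⟩]
  refine ⟨fun n => ?_, by simpa using h1 0, ?_⟩
  · by_cases hn : n ∈ Set.range (fun j : ℕ => i * j)
    · obtain ⟨j, rfl⟩ := hn
      rw [h1]; norm_num
    · rw [h2 n hn]
  · refine (hinj.hasSum_iff fun n hn => by rw [h2 n hn, zero_mul]).1 ?_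
    convert hasSum_geometric_of_lt_one (pow_nonneg hx i) (pow_lt_one₀ hx hx1 hi) using 2 with j
    rw [Function.comp, h1, one_mul, pow_mul]

end HasNonnegValue

open PowerSeries.WithPiTopology in
/-- If the logarithms of the factors of an infinite product of power series sum to `L`, then the
product has value `exp L`. -/
theorem hasSum_coeff_of_hasProd {G : ℕ → ℝ⟦X⟧} {P : ℝ⟦X⟧} {x L : ℝ} {l : ℕ → ℝ} (hx : 0 ≤ x)
    (hG : ∀ i, HasNonnegValue (G i) x (Real.exp (l i))) (hl : ∀ i, 0 ≤ l i) (hP : HasProd G P)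
    (hL : HasSum l L) : HasSum (fun n => coeff n P * x ^ n) (Real.exp L) := by
  have hpart : ∀ M, HasNonnegValue (∏ i ∈ Finset.range M, G i) x
      (Real.exp (∑ i ∈ Finset.range M, l i)) := by
    intro M
    induction M with
    | zero => simpa using HasNonnegValue.one x
    | succ M ih =>
      rw [Finset.prod_range_succ, Finset.sum_range_succ, Real.exp_add]
      exact ih.mul (hG M)
  have hlim : ∀ n, Tendsto (fun M => coeff n (∏ i ∈ Finset.range M, G i)) atTop
      (nhds (coeff n P)) := fun n =>
    ((continuous_coeff ℝ n).tendsto P).comp hP.tendsto_prod_nat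
  have hmono : ∀ n, Monotone fun M => coeff n (∏ i ∈ Finset.range M, G i) := fun n =>
    monotone_nat_of_le_succ fun M => by
      rw [Finset.prod_range_succ]
      exact (hpart M).coeff_le_coeff_mul (hG M) n
  have hle : ∀ M n, coeff n (∏ i ∈ Finset.range M, G i) ≤ coeff n P := fun M n =>
    (hmono n).ge_of_tendsto (hlim n) M
  have hnn : ∀ n, 0 ≤ coeff n P * x ^ n := fun n =>
    mul_nonneg (((hpart 0).coeff_nonneg n).trans (hle 0 n)) (pow_nonneg hx n)
  have hub : ∀ N, ∑ n ∈ Finset.range N, coeff n P * x ^ n ≤ Real.exp L := fun N =>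
    le_of_tendsto (tendsto_finsetSum _ fun n _ => (hlim n).mul_const _)
      (Eventually.of_forall fun M => (sum_le_hasSum _ (fun n _ =>
        mul_nonneg ((hpart M).coeff_nonneg n) (pow_nonneg hx n)) (hpart M).hasSum).trans
        (Real.exp_le_exp.2 (sum_le_hasSum _ (fun i _ => hl i) hL)))
  have hsum : Summable fun n => coeff n P * x ^ n := summable_of_sum_range_le hnn hub
  have hval : ∑' n, coeff n P * x ^ n = Real.exp L := by
    refine le_antisymm (Real.tsum_le_of_sum_range_le hnn hub) ?_
    refine le_of_tendsto ((Real.continuous_exp.tendsto L).comp hL.tendsto_sum_nat)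
      (Eventually.of_forall fun M => ?_)
    exact hasSum_le (fun n => mul_le_mul_of_nonneg_right (hle M n) (pow_nonneg hx n))
      (hpart M).hasSum hsum.hasSum
  exact hval ▸ hsum.hasSum

end

section

variable {k : ℕ}

theorem pk_monotone (k : ℕ) : Monotone (pk k) := by
  refine monotone_nat_of_le_succ fun n => ?_
  let F : {p : n.Partition // ∀ i ∈ p.parts, ∃ m : ℕ, i = m ^ k} →
      {p : (n + 1).Partition // ∀ i ∈ p.parts, ∃ m : ℕ, i = m ^ k} := fun p =>
    ⟨⟨1 ::ₘ p.1.parts, fun {i} hi => by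
        rcases Multiset.mem_cons.1 hi with rfl | hi
        · exact one_pos
        · exact p.1.parts_pos hi, by rw [Multiset.sum_cons, p.1.parts_sum, add_comm]⟩,
      fun i hi => by
        rcases Multiset.mem_cons.1 hi with rfl | hi
        · exact ⟨1, (one_pow k).symm⟩
        · exact p.2 i hi⟩
  refine Nat.card_le_card_of_injective F fun p q hpq => ?_
  have h := congrArg (fun r => r.1.parts) hpq
  exact Subtype.ext (Nat.Partition.ext ((Multiset.cons_inj_right 1).1 h))

theorem one_le_pk_zero (k : ℕ) : 1 ≤ pk k 0 := by
  refine Nat.card_pos_iff.2 ⟨⟨⟨Nat.Partition.indiscrete 0, fun i hi => ?_⟩⟩, inferInstance⟩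
  simp at hi

open Classical in
theorem pk_eq_card_restricted (k n : ℕ) :
    pk k n = (Nat.Partition.restricted n fun i => ∃ m : ℕ, i = m ^ k).card := by
  rw [pk, Nat.card_eq_fintype_card, Fintype.card_subtype, Nat.Partition.restricted]

theorem hasSum_ite_pow (hk : k ≠ 0) [DecidablePred fun i : ℕ => ∃ m : ℕ, i = m ^ k] {f : ℕ → ℝ}
    {v : ℝ} (h : HasSum (fun m : ℕ => f ((m + 1) ^ k)) v) :
    HasSum (fun i : ℕ => if ∃ m : ℕ, i + 1 = m ^ k then f (i + 1) else 0) v := by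
  have hφ : ∀ m : ℕ, (m + 1) ^ k - 1 + 1 = (m + 1) ^ k := fun m =>
    Nat.sub_add_cancel (Nat.one_le_pow _ _ m.succ_pos)
  have hinj : Function.Injective fun m : ℕ => (m + 1) ^ k - 1 := fun m n hmn => by
    have h1 : (m + 1) ^ k = (n + 1) ^ k := by rw [← hφ m, ← hφ n]; exact congrArg (· + 1) hmn
    exact Nat.succ_injective (Nat.pow_left_injective hk h1)
  refine (hinj.hasSum_iff fun i hi => if_neg ?_).1 ?_
  · rintro ⟨m, hm⟩
    refine hi ⟨m - 1, ?_⟩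
    have : m ≠ 0 := by rintro rfl; simp [hk] at hm
    simp only [Nat.sub_add_cancel (Nat.one_le_iff_ne_zero.2 this), ← hm, Nat.add_sub_cancel]
  · convert h using 2 with m
    simp only [Function.comp, hφ]
    exact if_pos ⟨m + 1, rfl⟩

theorem hasSum_pk_mul_exp (hk : k ≠ 0) {s : ℝ} (hs : 0 < s) :
    HasSum (fun n : ℕ => (pk k n : ℝ) * Real.exp (-(n * s))) (Real.exp (logGenFun k s)) := by
  classical
  have hx0 := (Real.exp_pos (-s)).le
  have hx1 : Real.exp (-s) < 1 := Real.exp_lt_one_iff.2 (neg_lt_zero.2 hs)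
  have hpow : ∀ n : ℕ, Real.exp (-(n * s)) = Real.exp (-s) ^ n := fun n => by
    rw [← Real.exp_nat_mul]; congr 1; ring
  have hlt : ∀ i : ℕ, i ≠ 0 → Real.exp (-s) ^ i < 1 := fun i hi => pow_lt_one₀ hx0 hx1 hi
  have h := hasSum_coeff_of_hasProd (x := Real.exp (-s)) (L := logGenFun k s)
    (l := fun i : ℕ => if ∃ m : ℕ, i + 1 = m ^ k then
      -Real.log (1 - Real.exp (-s) ^ (i + 1)) else 0) hx0 (fun i => ?_) (fun i => ?_)
    (Nat.Partition.hasProd_powerSeriesMk_card_restricted ℝ fun i => ∃ m : ℕ, i = m ^ k)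
    (hasSum_ite_pow (f := fun i => -Real.log (1 - Real.exp (-s) ^ i)) hk ?_)
  · simpa only [PowerSeries.coeff_mk, ← pk_eq_card_restricted, ← hpow] using h
  · split_ifs
    · rw [Real.exp_neg (Real.log _), Real.exp_log (sub_pos.2 (hlt _ i.succ_ne_zero))]
      exact HasNonnegValue.geometric i.succ_ne_zero hx0 hx1
    · rw [Real.exp_zero]
      exact HasNonnegValue.one _
  · split_ifs
    · exact neg_nonneg.2 (Real.log_nonpos (sub_nonneg.2 (hlt _ i.succ_ne_zero).le)
        (sub_le_self _ (pow_nonneg hx0 _)))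
    · exact le_rfl
  · simpa only [← hpow] using hasSum_neg_log_one_sub_exp hk hs

end

theorem zetaR_eq_tsum {x : ℝ} (hx : 1 < x) : zetaR x = ∑' n : ℕ, ((n : ℝ) + 1) ^ (-x) := by
  rw [zetaR, zeta_eq_tsum_one_div_nat_add_one_cpow (by simpa using hx)]
  have : ∀ n : ℕ, 1 / ((n : ℂ) + 1) ^ (x : ℂ) = (((n : ℝ) + 1) ^ (-x) : ℝ) := fun n => by
    rw [Real.rpow_neg (by positivity), Complex.ofReal_inv, Complex.ofReal_cpow (by positivity),
      one_div]
    push_cast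
    rfl
  simp_rw [this]
  rw [← Complex.ofReal_tsum, Complex.ofReal_re]

/-- Hardy–Ramanujan asymptotic equivalence:
`log p^k(n) ∼ (k+1) ((1/k²) ζ((k+1)/k) Γ(1/k))^{k/(k+1)} n^{1/(k+1)}`. -/
theorem log_power_partitions_asymptotic (k : ℕ) (hk : 2 ≤ k) :
    Filter.Tendsto (fun n : ℕ =>
      Real.log (pk k n) /
        (((k : ℝ) + 1) *
          ((1 / (k : ℝ) ^ 2) * zetaR (((k : ℝ) + 1) / k) * Real.Gamma (1 / k)) ^
            ((k : ℝ) / ((k : ℝ) + 1)) *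
          (n : ℝ) ^ (1 / ((k : ℝ) + 1))))
      Filter.atTop (nhds 1) := by
  have hk0 : k ≠ 0 := by omega
  have hk' : (0 : ℝ) < k := by positivity
  have hα : (0 : ℝ) < 1 / k := by positivity
  have hx : (1 : ℝ) < ((k : ℝ) + 1) / k := by rw [lt_div_iff₀ hk']; linarith
  have hexp : -(1 / (k : ℝ)) - 1 = -(((k : ℝ) + 1) / k) := by field_simp; ring
  have hzeta : zetaR (((k : ℝ) + 1) / k) = ∑' j : ℕ, ((j : ℝ) + 1) ^ (-(1 / (k : ℝ)) - 1) := by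
    rw [zetaR_eq_tsum hx, hexp]
  have hzpos : 0 < zetaR (((k : ℝ) + 1) / k) := by
    rw [hzeta]
    exact (summable_natCast_add_one_rpow (by linarith)).tsum_pos (fun j => by positivity) 0
      (by simp)
  have hΓ : 0 < Real.Gamma (1 / k) := Real.Gamma_pos_of_pos hα
  set B := (1 / (k : ℝ) ^ 2) * zetaR (((k : ℝ) + 1) / k) * Real.Gamma (1 / k) with hB
  have hBpos : 0 < B := by positivity
  have hlim := tendsto_rpow_mul_logGenFun hk0
  rw [← hzeta, Real.Gamma_add_one hα.ne', show 1 / (k : ℝ) * Real.Gamma (1 / k) *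
    zetaR (((k : ℝ) + 1) / k) = k * B by rw [hB]; field_simp] at hlim
  have main := tendsto_log_div_rpow_of_laplace (a := fun n => (pk k n : ℝ)) (L := logGenFun k)
    (fun m n hmn => Nat.cast_le.2 (pk_monotone k hmn)) (by exact_mod_cast one_le_pk_zero k)
    (mul_pos hk' hBpos) hα (fun s hs => hasSum_pk_mul_exp hk0 hs) hlim
  rw [show 1 / (k : ℝ) / (1 + 1 / k) = 1 / ((k : ℝ) + 1) by field_simp,
    show 1 / (1 + 1 / (k : ℝ)) = (k : ℝ) / (k + 1) by field_simp,
    show 1 / (k : ℝ) * (k * B) = B by field_simp,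
    show 1 + 1 / (1 / (k : ℝ)) = (k : ℝ) + 1 by field_simp; ring] at main
  have hC : ((k : ℝ) + 1) * B ^ ((k : ℝ) / (k + 1)) ≠ 0 := by positivity
  have := main.div_const (((k : ℝ) + 1) * B ^ ((k : ℝ) / (k + 1)))
  rw [div_self hC] at this
  refine this.congr fun n => ?_
  rw [div_div, mul_comm]
end

section
/- Fix an integer k ≥ 2 and let Φ_k(z) = Σ_{j=1}^{∞} Σ_{n=1}^{∞} (1/j) z^{j n^k}. Let X ≥ 1 and Θ ∈ ℝ, and set ρ = e^{−1/X}. Then for every real c > 1/k, Φ_k(ρ e(Θ)) = (1/(2πi)) ∫_{c−i∞}^{c+i∞} ζ(s+1) ζ(ks) (X/(1 − 2πiXΘ))^{s} Γ(s) ds, where (X/(1−2πiXΘ))^{s} = exp(s log(X/(1−2πiXΘ))) with the logarithm defined by continuous variation of log(X/(1−2πiXθ)) as θ varies continuously from 0 to Θ through real values. -/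
open Real Complex Filter MeasureTheory

/-- `e(α) = e^{2πiα}`. -/
noncomputable def eu (x : ℝ) : ℂ := Complex.exp (2 * Real.pi * Complex.I * x)

/-- `Φ_k(z) = ∑_{j≥1} ∑_{n≥1} (1/j) z^{j n^k}`. -/
noncomputable def Phi (k : ℕ) (z : ℂ) : ℂ :=
  ∑' (j : ℕ+) (n : ℕ+), (1 / (j : ℂ)) * z ^ ((j : ℕ) * (n : ℕ) ^ k)

theorem integrableOn_rpow_mul_exp_neg {a b : ℝ} (ha : 0 < a) (hb : 0 < b) :
    IntegrableOn (fun t : ℝ => t ^ (a - 1) * Real.exp (-b * t)) (Set.Ioi 0) := by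
  simpa using integrableOn_rpow_mul_exp_neg_mul_rpow (p := 1) (s := a - 1) (by linarith) one_pos hb

theorem norm_cpow_mul_cexp_neg (s w : ℂ) {t : ℝ} (ht : 0 < t) :
    ‖(t : ℂ) ^ (s - 1) * cexp (-w * t)‖ = t ^ (s.re - 1) * Real.exp (-w.re * t) := by
  rw [norm_mul, norm_cpow_eq_rpow_re_of_pos ht, Complex.norm_exp]
  simp

theorem aestronglyMeasurable_cpow_mul_cexp_neg (s w : ℂ) :
    AEStronglyMeasurable (fun t : ℝ => (t : ℂ) ^ (s - 1) * cexp (-w * t))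
      (volume.restrict (Set.Ioi 0)) := by
  refine ContinuousOn.aestronglyMeasurable (fun t ht => ?_) measurableSet_Ioi
  refine ContinuousAt.continuousWithinAt (ContinuousAt.mul ?_ (by fun_prop))
  exact continuousAt_ofReal_cpow_const _ _ (Or.inr ht.ne')

theorem integrableOn_cpow_mul_cexp_neg {s w : ℂ} (hs : 0 < s.re) (hw : 0 < w.re) :
    IntegrableOn (fun t : ℝ => (t : ℂ) ^ (s - 1) * cexp (-w * t)) (Set.Ioi 0) := by
  refine (integrableOn_rpow_mul_exp_neg hs hw).mono' (aestronglyMeasurable_cpow_mul_cexp_neg s w) ?_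
  filter_upwards [ae_restrict_mem measurableSet_Ioi] with t ht
  exact (norm_cpow_mul_cexp_neg s w ht).le

theorem differentiableAt_integral_cpow_mul_cexp_neg {s w : ℂ} (hs : 0 < s.re) (hw : 0 < w.re) :
    DifferentiableAt ℂ
      (fun z : ℂ => ∫ t : ℝ in Set.Ioi 0, (t : ℂ) ^ (s - 1) * cexp (-z * t)) w := by
  have hre : ∀ z ∈ Metric.ball w (w.re / 2), w.re / 2 < z.re := fun z hz => by
    have h := (abs_re_le_norm (z - w)).trans_lt (by simpa [dist_eq_norm] using hz)
    rw [sub_re, abs_lt] at h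
    linarith [h.1]
  refine (hasDerivAt_integral_of_dominated_loc_of_deriv_le
    (F' := fun z t => (t : ℂ) ^ (s + 1 - 1) * cexp (-z * t) * (-1))
    (bound := fun t => t ^ (s.re + 1 - 1) * Real.exp (-(w.re / 2) * t))
    (Metric.ball_mem_nhds w (half_pos hw))
    (Eventually.of_forall fun z => aestronglyMeasurable_cpow_mul_cexp_neg s z)
    (integrableOn_cpow_mul_cexp_neg hs hw)
    ((aestronglyMeasurable_cpow_mul_cexp_neg (s + 1) w).mul_const _)
    ?_ (integrableOn_rpow_mul_exp_neg (by linarith) (half_pos hw)) ?_).2.differentiableAt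
  · filter_upwards [ae_restrict_mem measurableSet_Ioi] with t ht z hz
    rw [norm_mul, norm_cpow_mul_cexp_neg _ _ ht]
    have h := hre z hz
    have ht' : 0 < t := ht
    simp only [add_re, one_re, norm_neg, norm_one, mul_one]
    gcongr
  · filter_upwards [ae_restrict_mem measurableSet_Ioi] with t ht z hz
    have ht' : (t : ℂ) ≠ 0 := ofReal_ne_zero.2 (ne_of_gt ht)
    have h1 : HasDerivAt (fun z : ℂ => -z * t) (-1 * t) z := (hasDerivAt_neg z).mul_const _
    convert! h1.cexp.const_mul ((t : ℂ) ^ (s - 1)) using 1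
    rw [show s + 1 - 1 = s - 1 + 1 by ring, cpow_add _ _ ht', cpow_one]
    ring

/-- Euler's integral with a complex scaling parameter in the right half plane. -/
theorem integral_cpow_mul_cexp_neg {s w : ℂ} (hs : 0 < s.re) (hw : 0 < w.re) :
    ∫ t : ℝ in Set.Ioi 0, (t : ℂ) ^ (s - 1) * cexp (-w * t) = Gamma s * w ^ (-s) := by
  have hopen : IsOpen {z : ℂ | 0 < z.re} := isOpen_lt continuous_const continuous_re
  have hF : AnalyticOnNhd ℂ
      (fun z : ℂ => ∫ t : ℝ in Set.Ioi 0, (t : ℂ) ^ (s - 1) * cexp (-z * t)) {z | 0 < z.re} :=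
    DifferentiableOn.analyticOnNhd (fun z hz =>
      (differentiableAt_integral_cpow_mul_cexp_neg hs hz).differentiableWithinAt) hopen
  have hG : AnalyticOnNhd ℂ (fun z : ℂ => Gamma s * z ^ (-s)) {z | 0 < z.re} :=
    DifferentiableOn.analyticOnNhd (fun z hz => ((differentiableAt_id.cpow_const
      (Or.inl hz)).const_mul _).differentiableWithinAt) hopen
  refine hF.eqOn_of_preconnected_of_frequently_eq hG
    (convex_halfSpace_re_gt 0).isPreconnected (z₀ := 1) (by simp) ?_ hw
  have key : ∀ r : ℝ, 0 < r → ∫ t : ℝ in Set.Ioi 0, (t : ℂ) ^ (s - 1) * cexp (-(r : ℂ) * t) =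
      Gamma s * (r : ℂ) ^ (-s) := fun r hr => by
    have h := integral_cpow_mul_exp_neg_mul_Ioi hs hr
    simp_rw [neg_mul]
    rw [h, one_div, inv_cpow _ _ (by rw [arg_ofReal_of_nonneg hr.le]; exact pi_pos.ne), cpow_neg,
      mul_comm]
  have htend : Tendsto (fun r : ℝ => (r : ℂ)) (nhdsWithin 1 {1}ᶜ) (nhdsWithin 1 {1}ᶜ) := by
    refine tendsto_nhdsWithin_iff.2 ⟨?_, ?_⟩
    · exact (continuous_ofReal.tendsto' 1 1 (by simp)).mono_left nhdsWithin_le_nhds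
    · filter_upwards [self_mem_nhdsWithin] with r hr
      simpa using hr
  refine htend.frequently (Eventually.frequently ?_)
  filter_upwards [nhdsWithin_le_nhds (lt_mem_nhds (zero_lt_one' ℝ))] with r hr using key r hr

/-- Exponential decay of `Γ` on vertical lines, at any rate less than `π / 2`. -/
theorem norm_Gamma_vertical_le {c ψ : ℝ} (hc : 0 < c) (hψ : |ψ| < π / 2) (t : ℝ) :
    ‖Gamma (c + t * I)‖ ≤ (1 / Real.cos ψ) ^ c * Real.Gamma c * Real.exp (-ψ * t) := by
  have hcos : 0 < Real.cos ψ := cos_pos_of_mem_Ioo (abs_lt.1 hψ)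
  have hre : (cexp (ψ * I)).re = Real.cos ψ := exp_ofReal_mul_I_re ψ
  have hlog : Complex.log (cexp (ψ * I)) = ψ * I := by
    have := abs_lt.1 hψ
    rw [Complex.log_exp] <;> simp <;> linarith [pi_pos]
  have h := integral_cpow_mul_cexp_neg (s := c + t * I) (w := cexp (ψ * I)) (by simpa)
    (by rwa [hre])
  have hn : ‖cexp (ψ * I) ^ (-(c + t * I : ℂ))‖ = Real.exp (ψ * t) := by
    rw [cpow_def_of_ne_zero (Complex.exp_ne_zero _), hlog, Complex.norm_exp]
    simp
  have hle : ‖Gamma (c + t * I)‖ * Real.exp (ψ * t) ≤ (1 / Real.cos ψ) ^ c * Real.Gamma c := by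
    rw [← hn, ← norm_mul, ← h, ← Real.integral_rpow_mul_exp_neg_mul_Ioi hc hcos]
    refine (norm_integral_le_integral_norm _).trans_eq
      (setIntegral_congr_fun measurableSet_Ioi fun x hx => ?_)
    rw [norm_cpow_mul_cexp_neg _ _ hx, hre]
    simp
  calc ‖Gamma (c + t * I)‖
      = ‖Gamma (c + t * I)‖ * Real.exp (ψ * t) * Real.exp (-ψ * t) := by
        rw [mul_assoc, ← Real.exp_add]; simp
    _ ≤ _ := by gcongr

theorem integrable_Gamma_mul_cpow {c : ℝ} {w : ℂ} (hc : 0 < c) (hw : 0 < w.re) :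
    Integrable (fun t : ℝ => Gamma (c + t * I) * w ^ (-(c + t * I : ℂ))) := by
  have hw0 : w ≠ 0 := fun h => by simp [h] at hw
  have harg : |w.arg| < π / 2 := abs_arg_lt_pi_div_two_iff.2 (Or.inl hw)
  obtain ⟨ψ, hψ1, hψ2⟩ := exists_between harg
  have hψ0 : 0 < ψ := (abs_nonneg _).trans_lt hψ1
  have hψ : |ψ| < π / 2 := by rwa [abs_of_pos hψ0]
  have hargs := abs_lt.1 hψ1
  have hcont : Continuous (fun t : ℝ => Gamma (c + t * I) * w ^ (-(c + t * I : ℂ))) := by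
    refine continuous_iff_continuousAt.2 fun t => ContinuousAt.mul ?_ ?_
    · refine ContinuousAt.comp (f := fun t : ℝ => (c + t * I : ℂ)) ?_ (by fun_prop)
      refine (differentiableAt_Gamma _ fun m h => ?_).continuousAt
      have := congrArg re h
      simp at this
      linarith [m.cast_nonneg (α := ℝ)]
    · exact ContinuousAt.const_cpow (by fun_prop) (Or.inl hw0)
  have hn : ∀ t : ℝ, ‖w ^ (-(c + t * I : ℂ))‖ =
      Real.exp (-c * Real.log ‖w‖) * Real.exp (w.arg * t) := fun t => by
    rw [cpow_def_of_ne_zero hw0, Complex.norm_exp, ← Real.exp_add]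
    congr 1
    simp [log_re, log_im]
    ring
  have hbound : ∀ φ : ℝ, |φ| < π / 2 → ∀ t : ℝ, ‖Gamma (c + t * I) * w ^ (-(c + t * I : ℂ))‖ ≤
      (1 / Real.cos φ) ^ c * Real.Gamma c * Real.exp (-c * Real.log ‖w‖) *
        Real.exp ((w.arg - φ) * t) := fun φ hφ t => by
    rw [norm_mul, hn]
    calc _ ≤ (1 / Real.cos φ) ^ c * Real.Gamma c * Real.exp (-φ * t) *
          (Real.exp (-c * Real.log ‖w‖) * Real.exp (w.arg * t)) := by
          gcongr
          exact norm_Gamma_vertical_le hc hφ t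
      _ = _ := by
          rw [show (w.arg - φ) * t = -φ * t + w.arg * t by ring, Real.exp_add]
          ring
  rw [← integrableOn_univ, ← Set.Iic_union_Ioi (a := (0 : ℝ))]
  refine IntegrableOn.union ?_ ?_
  · exact Integrable.mono' ((integrableOn_exp_mul_Iic (a := w.arg - -ψ) (by linarith) 0).const_mul _)
      hcont.aestronglyMeasurable (ae_of_all _ (hbound (-ψ) (by rwa [abs_neg])))
  · exact Integrable.mono' ((integrableOn_exp_mul_Ioi (a := w.arg - ψ) (by linarith) 0).const_mul _)
      hcont.aestronglyMeasurable (ae_of_all _ (hbound ψ hψ))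

/-- The Cahen–Mellin integral. -/
theorem cexp_neg_eq_mellinInv {c x : ℝ} {w : ℂ} (hc : 0 < c) (hw : 0 < w.re) (hx : 0 < x) :
    cexp (-w * x) = (1 / (2 * (π : ℂ))) *
      ∫ t : ℝ, (x : ℂ) ^ (-(c + t * I : ℂ)) * (Gamma (c + t * I) * w ^ (-(c + t * I : ℂ))) := by
  have hm : ∀ s : ℂ, 0 < s.re →
      mellin (fun t : ℝ => cexp (-w * t)) s = Gamma s * w ^ (-s) := fun s hs =>
    integral_cpow_mul_cexp_neg hs hw
  have hm' : ∀ t : ℝ, mellin (fun t : ℝ => cexp (-w * t)) (c + t * I) =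
      Gamma (c + t * I) * w ^ (-(c + t * I : ℂ)) := fun t => hm _ (by simpa)
  rw [← mellinInv_mellin_eq c (fun t : ℝ => cexp (-w * t)) hx
    (integrableOn_cpow_mul_cexp_neg (by simpa) hw)
    (by simpa only [VerticalIntegrable, hm'] using integrable_Gamma_mul_cpow hc hw)
    (by fun_prop)]
  simp only [mellinInv, hm', smul_eq_mul, Complex.real_smul]
  push_cast
  rfl

theorem hasSum_pnat_cpow_neg {s : ℂ} (hs : 1 < s.re) :
    HasSum (fun n : ℕ+ => (n : ℂ) ^ (-s)) (riemannZeta s) := by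
  have h : HasSum (fun n : ℕ => (n : ℂ) ^ (-s)) (riemannZeta s) := by
    have := (Complex.summable_one_div_nat_cpow.2 hs).hasSum
    rw [← zeta_eq_tsum_one_div_nat_cpow hs] at this
    simpa only [one_div, ← cpow_neg] using this
  refine (PNat.coe_injective.hasSum_iff (f := fun n : ℕ => (n : ℂ) ^ (-s)) fun n hn => ?_).2 h
  have hn0 : n = 0 := by
    by_contra h0
    exact hn ⟨⟨n, Nat.pos_of_ne_zero h0⟩, rfl⟩
  rw [hn0, Nat.cast_zero, zero_cpow]
  intro h0
  rw [neg_eq_zero] at h0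
  norm_num [h0] at hs

/-- The `(j, n)`-term of the double Dirichlet series of `ζ(s + 1) ζ(k s)`. -/
theorem one_div_mul_cpow_neg (k : ℕ) (j n : ℕ+) (s : ℂ) :
    (1 / (j : ℂ)) * (((j : ℝ) * (n : ℝ) ^ k : ℝ) : ℂ) ^ (-s) =
      (j : ℂ) ^ (-(s + 1)) * (n : ℂ) ^ (-(k * s)) := by
  have hj : (j : ℂ) ≠ 0 := by exact_mod_cast j.ne_zero
  have hn : ((n : ℂ) ^ k) ^ (-s) = (n : ℂ) ^ (-(k * s)) := by
    rw [← mul_neg, natCast_cpow_natCast_mul]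
  rw [ofReal_mul, mul_cpow_ofReal_nonneg (by positivity) (by positivity)]
  push_cast
  rw [hn, neg_add, cpow_add _ _ hj, cpow_neg_one]
  ring

theorem hasSum_one_div_mul_cpow_neg {k : ℕ} {s : ℂ} (hs : 0 < s.re) (hks : 1 < k * s.re) :
    HasSum (fun p : ℕ+ × ℕ+ => (1 / (p.1 : ℂ)) * (((p.1 : ℝ) * (p.2 : ℝ) ^ k : ℝ) : ℂ) ^ (-s))
      (riemannZeta (s + 1) * riemannZeta (k * s)) := by
  have h1 : HasSum (fun j : ℕ+ => (j : ℂ) ^ (-(s + 1))) (riemannZeta (s + 1)) :=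
    hasSum_pnat_cpow_neg (by simpa)
  have h2 : HasSum (fun n : ℕ+ => (n : ℂ) ^ (-(k * s))) (riemannZeta (k * s)) :=
    hasSum_pnat_cpow_neg (by simpa)
  have h12 := summable_mul_of_summable_norm h1.summable.norm h2.summable.norm
  simpa only [one_div_mul_cpow_neg] using h1.mul h2 h12

/-- Termwise Mellin inversion of `∑ (1 / j) e^{-w j n^k}`. -/
theorem hasSum_cexp_neg_mul_pow {k : ℕ} {c : ℝ} {w : ℂ} (hc : 0 < c) (hkc : 1 < k * c)
    (hw : 0 < w.re) :
    HasSum (fun p : ℕ+ × ℕ+ => (1 / (p.1 : ℂ)) * cexp (-w * ((p.1 : ℝ) * (p.2 : ℝ) ^ k : ℝ)))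
      ((1 / (2 * (π : ℂ))) * ∫ t : ℝ, riemannZeta (c + t * I + 1) * riemannZeta (k * (c + t * I)) *
        (Gamma (c + t * I) * w ^ (-(c + t * I : ℂ)))) := by
  have hΓw := integrable_Gamma_mul_cpow hc hw
  have hx : ∀ p : ℕ+ × ℕ+, (0 : ℝ) < (p.1 : ℝ) * (p.2 : ℝ) ^ k := fun p => by
    have h1 : (0 : ℝ) < p.1 := by exact_mod_cast p.1.pos
    have h2 : (0 : ℝ) < p.2 := by exact_mod_cast p.2.pos
    positivity
  have hnorm : ∀ (p : ℕ+ × ℕ+) (t : ℝ),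
      ‖(1 / (p.1 : ℂ)) * (((p.1 : ℝ) * (p.2 : ℝ) ^ k : ℝ) : ℂ) ^ (-(c + t * I : ℂ))‖ =
        ‖(1 / (p.1 : ℂ)) * (((p.1 : ℝ) * (p.2 : ℝ) ^ k : ℝ) : ℂ) ^ (-(c : ℂ))‖ := fun p t => by
    rw [norm_mul, norm_mul, norm_cpow_eq_rpow_re_of_pos (hx p), norm_cpow_eq_rpow_re_of_pos (hx p)]
    simp
  have hterm : ∀ p : ℕ+ × ℕ+, Integrable fun t : ℝ =>
      (1 / (p.1 : ℂ)) * (((p.1 : ℝ) * (p.2 : ℝ) ^ k : ℝ) : ℂ) ^ (-(c + t * I : ℂ)) *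
        (Gamma (c + t * I) * w ^ (-(c + t * I : ℂ))) := fun p => by
    refine hΓw.bdd_mul (Continuous.aestronglyMeasurable ?_) (ae_of_all _ fun t => (hnorm p t).le)
    refine continuous_const.mul (continuous_iff_continuousAt.2 fun t => ?_)
    exact ContinuousAt.const_cpow (by fun_prop) (Or.inl (ofReal_ne_zero.2 (hx p).ne'))
  have hsum := hasSum_integral_of_summable_integral_norm hterm (by
    simp_rw [norm_mul _ (Complex.Gamma _ * _), hnorm, integral_const_mul]
    exact ((hasSum_one_div_mul_cpow_neg (s := c) (by simpa) (by simpa)).summable.norm).mul_right _)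
  convert! hsum.mul_left (1 / (2 * (π : ℂ))) using 1
  · funext p
    rw [cexp_neg_eq_mellinInv hc hw (hx p)]
    simp_rw [mul_assoc (1 / (p.1 : ℂ)), integral_const_mul]
    ring
  · congr 2
    funext t
    rw [tsum_mul_right, (hasSum_one_div_mul_cpow_neg (s := c + t * I) (by simpa)
      (by simpa)).tsum_eq]

/-- **Mellin representation.** For `X ≥ 1`, `Θ ∈ ℝ` and every real `c > 1/k`,
`Φ_k(ρe(Θ)) = (1/2πi) ∫_{c-i∞}^{c+i∞} ζ(s+1)ζ(ks)(X/(1-2πiXΘ))^s Γ(s) ds`,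
the vertical line integral being parametrised as `s = c + it`, `ds = i dt`, and the power
`(X/(1-2πiXΘ))^s = exp(s(log X - Log(1-2πiXΘ)))` with the principal logarithm (the branch
obtained by continuous variation from `Θ = 0`). -/
theorem Phi_mellin_representation (k : ℕ) (hk : 2 ≤ k) (X Θ : ℝ) (hX : 1 ≤ X)
    (c : ℝ) (hc : 1 / (k : ℝ) < c) :
    Phi k ((Real.exp (-1 / X) : ℂ) * eu Θ) =
      (1 / (2 * (π : ℂ) * Complex.I)) *
        ∫ t : ℝ,
          riemannZeta (((c : ℂ) + (t : ℂ) * Complex.I) + 1) *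
          riemannZeta ((k : ℂ) * ((c : ℂ) + (t : ℂ) * Complex.I)) *
          Complex.exp (((c : ℂ) + (t : ℂ) * Complex.I) *
            ((Real.log X : ℂ) - Complex.log (1 - 2 * (π : ℂ) * (X : ℂ) * (Θ : ℂ) * Complex.I))) *
          Complex.Gamma ((c : ℂ) + (t : ℂ) * Complex.I) * Complex.I := by
  have hX0 : 0 < X := by linarith
  have hk0 : (0 : ℝ) < k := by exact_mod_cast (by omega : 0 < k)
  have hc0 : 0 < c := (by positivity : 0 < 1 / (k : ℝ)).trans hc
  have hkc : 1 < k * c := by rwa [div_lt_iff₀' hk0] at hc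
  set u : ℂ := 1 - 2 * (π : ℂ) * (X : ℂ) * (Θ : ℂ) * I with hu
  have hure : u.re = 1 := by simp [hu]
  have hu0 : u ≠ 0 := fun h => by simp [h] at hure
  set w : ℂ := u * ((X⁻¹ : ℝ) : ℂ) with hwdef
  have hw : 0 < w.re := by
    rw [hwdef, re_mul_ofReal, hure, one_mul]
    positivity
  have hw0 : w ≠ 0 := fun h => by simp [h] at hw
  have hlog : Complex.log w = Complex.log u - Real.log X := by
    rw [hwdef, log_mul_ofReal _ (by positivity) _ hu0, Real.log_inv]
    push_cast
    ring
  have hz : (Real.exp (-1 / X) : ℂ) * eu Θ = cexp (-w) := by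
    have hXC : (X : ℂ) ≠ 0 := ofReal_ne_zero.2 hX0.ne'
    rw [eu, ofReal_exp, ← Complex.exp_add]
    congr 1
    rw [hwdef, hu]
    push_cast
    field_simp
    ring
  have hS := hasSum_cexp_neg_mul_pow hc0 hkc hw
  have hPhi : Phi k (cexp (-w)) = ∑' p : ℕ+ × ℕ+,
      (1 / (p.1 : ℂ)) * cexp (-w * ((p.1 : ℝ) * (p.2 : ℝ) ^ k : ℝ)) := by
    rw [hS.summable.tsum_prod, Phi]
    refine tsum_congr fun j => tsum_congr fun n => ?_
    rw [← Complex.exp_nat_mul]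
    push_cast
    ring_nf
  rw [hz, hPhi, hS.tsum_eq, integral_mul_const]
  have hI : ∀ A : ℂ, 1 / (2 * (π : ℂ) * I) * (A * I) = 1 / (2 * (π : ℂ)) * A := fun A => by
    have hπ : (π : ℂ) ≠ 0 := ofReal_ne_zero.2 pi_ne_zero
    field_simp
  rw [hI]
  congr 2
  funext t
  rw [cpow_def_of_ne_zero hw0, hlog]
  ring_nf
end
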